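/- Let 0 < k < n and let V be a k-dimensional linear subspace of ℝ^n, with orthogonal complement V^⊥. The following are equivalent: (a) V is totally positive, i.e. V ∈ Gr>0_{k,n}; (b) var̄(v) ≤ k−1 for all nonzero v ∈ V; (c) var(w) ≥ k for all nonzero w ∈ V^⊥. -/

import Mathlib

noncomputable section

/-- The Pluecker coordinate of the full-rank `k x n` matrix `C` on the column set `S`
(the minor on the columns in `S`, taken in increasing order). -/
def pluck {k n : ℕ} (C : Matrix (Fin k) (Fin n) ℝ) (S : Finset (Fin n))
    (h : S.card = k) : ℝ :=
  (C.submatrix id (fun t => ((S.orderIsoOfFin h) t).val)).det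

/-- `signChanges v` is `var(v)`: the number of sign changes in the sequence
`v 0, ..., v (n-1)`, ignoring zero entries. -/
def signChanges {n : ℕ} (v : Fin n → ℝ) : ℕ :=
  sSup {m | ∃ f : Fin (m + 1) → Fin n, StrictMono f ∧
    ∀ j : Fin m, v (f j.castSucc) * v (f j.succ) < 0}

/-- `varBar v` is `var-bar(v)`: the maximum of `var(w)` over all `w` agreeing
with `v` on the nonzero entries of `v`. -/
def varBar {n : ℕ} (v : Fin n → ℝ) : ℕ :=
  sSup {m | ∃ w : Fin n → ℝ, (∀ i, v i ≠ 0 → w i = v i) ∧ signChanges w = m}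

/-- `V` is a totally positive point of the Grassmannian: up to a global sign
(absorbed into the choice of representative matrix), all Pluecker coordinates
of `V` are positive. -/
def TotPos (k : ℕ) {n : ℕ} (V : Submodule ℝ (Fin n → ℝ)) : Prop :=
  ∃ C : Matrix (Fin k) (Fin n) ℝ,
    LinearIndependent ℝ (fun i => C i) ∧
    Submodule.span ℝ (Set.range (fun i => C i)) = V ∧
    ∀ (S : Finset (Fin n)) (h : S.card = k), 0 < pluck C S h

open scoped Matrix

/-- `f` selects `m + 1` positions at which `v` strictly alternates in sign. -/
def IsSignChain {n m : ℕ} (v : Fin n → ℝ) (f : Fin (m + 1) → Fin n) : Prop :=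
  StrictMono f ∧ ∀ j : Fin m, v (f j.castSucc) * v (f j.succ) < 0

theorem IsSignChain.lt {n m : ℕ} {v : Fin n → ℝ} {f : Fin (m + 1) → Fin n}
    (hf : IsSignChain v f) : m < n := by
  simpa using Fintype.card_le_of_injective f hf.1.injective

theorem bddAbove_signChanges {n : ℕ} (v : Fin n → ℝ) :
    BddAbove {m | ∃ f : Fin (m + 1) → Fin n, IsSignChain v f} :=
  ⟨n, fun _ ⟨_, hf⟩ => hf.lt.le⟩

theorem IsSignChain.le_signChanges {n m : ℕ} {v : Fin n → ℝ} {f : Fin (m + 1) → Fin n}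
    (hf : IsSignChain v f) : m ≤ signChanges v :=
  le_csSup (bddAbove_signChanges v) ⟨f, hf⟩

theorem exists_isSignChain {n : ℕ} (hn : 0 < n) (v : Fin n → ℝ) :
    ∃ f : Fin (signChanges v + 1) → Fin n, IsSignChain v f := by
  refine Nat.sSup_mem
      (s := {m | ∃ f : Fin (m + 1) → Fin n, IsSignChain v f})
    ⟨0, fun _ => ⟨0, hn⟩, Subsingleton.strictMono (α := Fin 1) _, fun j => j.elim0⟩
    (bddAbove_signChanges v)

theorem signChanges_le {n : ℕ} (v : Fin n → ℝ) : signChanges v ≤ n := by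
  rcases Nat.eq_zero_or_pos n with rfl | hn
  · refine csSup_le' fun m ⟨f, _⟩ => (f 0).elim0
  · obtain ⟨f, hf⟩ := exists_isSignChain hn v
    exact hf.lt.le

theorem exists_isSignChain_of_le {n k : ℕ} (hn : 0 < n) {v : Fin n → ℝ}
    (hk : k ≤ signChanges v) : ∃ f : Fin (k + 1) → Fin n, IsSignChain v f := by
  obtain ⟨f, hf, hf'⟩ := exists_isSignChain hn v
  have hk' : k + 1 ≤ signChanges v + 1 := by omega
  refine ⟨fun j => f (j.castLE hk'), hf.comp (Fin.strictMono_castLE hk'), fun j => ?_⟩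
  exact hf' (j.castLE hk)

theorem IsSignChain.ne_zero {n m : ℕ} {v : Fin n → ℝ} {f : Fin (m + 1) → Fin n}
    (hf : IsSignChain v f) (hm : 0 < m) (j : Fin (m + 1)) : v (f j) ≠ 0 := by
  intro h
  induction j using Fin.cases with
  | zero =>
    have := hf.2 ⟨0, hm⟩
    change v (f 0) * _ < 0 at this
    simp [h] at this
  | succ j =>
    have := hf.2 j
    simp [h] at this

theorem IsSignChain.alternates {n m : ℕ} {v : Fin n → ℝ} {f : Fin (m + 1) → Fin n}
    (hf : IsSignChain v f) (h0 : v (f 0) ≠ 0) (j : Fin (m + 1)) :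
    0 < v (f 0) * (-1) ^ (j : ℕ) * v (f j) := by
  induction j using Fin.induction with
  | zero => simpa using mul_self_pos.2 h0
  | succ j ih =>
    have h := hf.2 j
    simp only [Fin.val_castSucc, Fin.val_succ, pow_succ] at ih ⊢
    have h2 := mul_pos_of_neg_of_neg h (neg_neg_of_pos ih)
    have h3 : 0 < v (f j.castSucc) ^ 2 := by
      have : v (f j.castSucc) ≠ 0 := by rintro h'; simp [h'] at h
      positivity
    refine pos_of_mul_pos_right (a := v (f j.castSucc) ^ 2) ?_ h3.le
    nlinarith

theorem isSignChain_of_alternates {n m : ℕ} {v : Fin n → ℝ} {f : Fin (m + 1) → Fin n}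
    (hf : StrictMono f) {s : ℝ} (h : ∀ j : Fin (m + 1), 0 < s * (-1) ^ (j : ℕ) * v (f j)) :
    IsSignChain v f := by
  refine ⟨hf, fun j => ?_⟩
  have h1 := mul_pos (h j.castSucc) (h j.succ)
  have hs : ((-1 : ℝ) ^ (j : ℕ)) ^ 2 = 1 := by rw [← pow_mul, mul_comm, pow_mul]; simp
  simp only [Fin.val_castSucc, Fin.val_succ, pow_succ] at h1
  have : s * (-1) ^ (j : ℕ) * v (f j.castSucc) * (s * ((-1) ^ (j : ℕ) * -1) * v (f j.succ))
      = s ^ 2 * -(v (f j.castSucc) * v (f j.succ)) * ((-1 : ℝ) ^ (j : ℕ)) ^ 2 := by ring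
  rw [this, hs, mul_one] at h1
  have := pos_of_mul_pos_right h1 (sq_nonneg s)
  linarith

theorem IsSignChain.succ_le_signChanges {n m : ℕ} {v : Fin n → ℝ} {f : Fin (m + 1) → Fin n}
    (hf : IsSignChain v f) {x : Fin n} (hx : f (Fin.last m) < x)
    (hv : v (f (Fin.last m)) * v x < 0) : m + 1 ≤ signChanges v := by
  refine IsSignChain.le_signChanges (f := Fin.snoc (α := fun _ => Fin n) f x) ⟨?_, fun j => ?_⟩
  · refine Fin.strictMono_iff_lt_succ.2 fun j => ?_
    induction j using Fin.lastCases with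
    | last => simpa using hx
    | cast j =>
      rw [← Fin.castSucc_succ, Fin.snoc_castSucc, Fin.snoc_castSucc]
      exact hf.1 Fin.castSucc_lt_succ
  · induction j using Fin.lastCases with
    | last => simpa using hv
    | cast j =>
      rw [← Fin.castSucc_succ, Fin.snoc_castSucc, Fin.snoc_castSucc]
      exact hf.2 j

theorem le_varBar_iff {n k : ℕ} (hk : 0 < k) (hn : 0 < n) (v : Fin n → ℝ) :
    k ≤ varBar v ↔ ∃ f : Fin (k + 1) → Fin n, StrictMono f ∧
      ∃ s : ℝ, s ≠ 0 ∧ ∀ j : Fin (k + 1), 0 ≤ s * (-1) ^ (j : ℕ) * v (f j) := by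
  have hbdd : BddAbove {m | ∃ w : Fin n → ℝ, (∀ i, v i ≠ 0 → w i = v i) ∧ signChanges w = m} :=
    ⟨n, fun _ ⟨w, _, hw⟩ => hw ▸ signChanges_le w⟩
  constructor
  · intro h
    obtain ⟨w, hw, hwm⟩ := Nat.sSup_mem
      (s := {m | ∃ w : Fin n → ℝ, (∀ i, v i ≠ 0 → w i = v i) ∧ signChanges w = m})
      ⟨_, v, fun _ _ => rfl, rfl⟩ hbdd
    obtain ⟨f, hf⟩ := exists_isSignChain_of_le hn (h.trans hwm.ge)
    have h0 := hf.ne_zero hk 0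
    refine ⟨f, hf.1, w (f 0), h0, fun j => ?_⟩
    rcases eq_or_ne (v (f j)) 0 with hv | hv
    · simp [hv]
    · rw [← hw _ hv]
      exact (hf.alternates h0 j).le
  · rintro ⟨f, hf, s, hs, h⟩
    let w : Fin n → ℝ := fun i =>
      if v i = 0 then Function.extend f (fun j : Fin (k + 1) => s * (-1) ^ (j : ℕ)) 0 i else v i
    refine le_trans ?_ (le_csSup hbdd ⟨w, fun i hi => if_neg hi, rfl⟩)
    refine (isSignChain_of_alternates hf (s := s) fun j => ?_).le_signChanges
    have hne : s * (-1) ^ (j : ℕ) ≠ 0 := mul_ne_zero hs (pow_ne_zero _ (by norm_num))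
    by_cases hv : v (f j) = 0
    · simpa [w, hv, hf.injective.extend_apply] using mul_self_pos.2 hne
    · simpa [w, hv] using lt_of_le_of_ne (h j) (mul_ne_zero hne hv).symm

/-- The minor of `C` on the columns listed by `f`. -/
def columnMinor {k n : ℕ} (C : Matrix (Fin k) (Fin n) ℝ) (f : Fin k → Fin n) : ℝ :=
  (C.submatrix id f).det

theorem pluck_eq_columnMinor {k n : ℕ} (C : Matrix (Fin k) (Fin n) ℝ) (S : Finset (Fin n))
    (h : S.card = k) : pluck C S h = columnMinor C (S.orderEmbOfFin h) := rfl

theorem forall_pluck_pos_iff {k n : ℕ} (C : Matrix (Fin k) (Fin n) ℝ) :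
    (∀ (S : Finset (Fin n)) (h : S.card = k), 0 < pluck C S h) ↔
      ∀ f : Fin k → Fin n, StrictMono f → 0 < columnMinor C f := by
  refine ⟨fun H f hf => ?_, fun H S h => H _ (S.orderEmbOfFin h).strictMono⟩
  have hS : (Finset.univ.image f).card = k := by
    simp [Finset.card_image_of_injective _ hf.injective]
  have := H _ hS
  rwa [pluck_eq_columnMinor,
    ← Finset.orderEmbOfFin_unique hS (f := f) (by simp) hf] at this

theorem sum_alternating_columnMinor {k n : ℕ} (C : Matrix (Fin k) (Fin n) ℝ)
    (e : Fin (k + 1) → Fin n) (x : Fin k → ℝ) :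
    ∑ a : Fin (k + 1), (-1) ^ (a : ℕ) * (x ᵥ* C) (e a) * columnMinor C (e ∘ a.succAbove) = 0 := by
  let A : Matrix (Fin (k + 1)) (Fin (k + 1)) ℝ :=
    Matrix.of (Fin.cons (fun a => (x ᵥ* C) (e a)) fun i a => C i (e a))
  have hA : A.det = 0 := by
    refine Matrix.exists_vecMul_eq_zero_iff.1 ⟨Fin.cons (-1) x, fun h => ?_, ?_⟩
    · simpa using congrFun h 0
    · ext a
      simp [A, Matrix.vecMul, dotProduct, Fin.sum_univ_succ]
  rw [Matrix.det_succ_row_zero] at hA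
  exact hA

theorem sum_mul_alternating_columnMinor {k n : ℕ} (C : Matrix (Fin k) (Fin n) ℝ)
    (e : Fin (k + 1) → Fin n) (i : Fin k) :
    ∑ a : Fin (k + 1), C i (e a) * ((-1) ^ (a : ℕ) * columnMinor C (e ∘ a.succAbove)) = 0 := by
  rw [← sum_alternating_columnMinor C e (Pi.single i 1)]
  refine Finset.sum_congr rfl fun a _ => ?_
  simp
  ring

/-- Any two strictly increasing selections are joined by single-column exchanges. -/
theorem columnMinor_mul_pos {k n : ℕ} (C : Matrix (Fin k) (Fin n) ℝ)
    (hne : ∀ f : Fin k → Fin n, StrictMono f → columnMinor C f ≠ 0)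
    (hex : ∀ e : Fin (k + 1) → Fin n, StrictMono e → ∀ a b : Fin (k + 1),
      0 < columnMinor C (e ∘ a.succAbove) * columnMinor C (e ∘ b.succAbove))
    {f g : Fin k → Fin n} (hf : StrictMono f) (hg : StrictMono g) :
    0 < columnMinor C f * columnMinor C g := by
  induction hd : (Finset.univ.image f \ Finset.univ.image g).card generalizing f with
  | zero =>
    have hsub : Finset.univ.image f ⊆ Finset.univ.image g := by
      simpa [Finset.sdiff_eq_empty_iff_subset] using hd
    have heq := Finset.eq_of_subset_of_card_le hsub
      (by simp [Finset.card_image_of_injective _ hf.injective,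
        Finset.card_image_of_injective _ hg.injective])
    have hr : Set.range f = Set.range g := by
      simpa using congrArg (fun s : Finset (Fin n) => (s : Set (Fin n))) heq
    rw [(hf.range_inj hg).1 hr]
    exact mul_self_pos.2 (hne g hg)
  | succ d ih =>
    have hcard : (Finset.univ.image f).card = (Finset.univ.image g).card := by
      simp [Finset.card_image_of_injective _ hf.injective,
        Finset.card_image_of_injective _ hg.injective]
    obtain ⟨x, hx⟩ : (Finset.univ.image f \ Finset.univ.image g).Nonempty := by
      rw [← Finset.card_pos]; omega
    obtain ⟨y, hy⟩ : (Finset.univ.image g \ Finset.univ.image f).Nonempty := by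
      rw [← Finset.card_pos, Finset.card_sdiff_comm hcard.symm]; omega
    rw [Finset.mem_sdiff] at hx hy
    have hI : (insert y (Finset.univ.image f)).card = k + 1 := by
      rw [Finset.card_insert_of_notMem hy.2, Finset.card_image_of_injective _ hf.injective]
      simp
    set e := (insert y (Finset.univ.image f)).orderEmbOfFin hI with he
    have hr : Set.range e = insert y (Set.range f) := by
      rw [he, Finset.range_orderEmbOfFin]; simp
    obtain ⟨a, ha⟩ : y ∈ Set.range e := by simp [hr]
    obtain ⟨b, hb⟩ : x ∈ Set.range e := by
      rw [hr]; right; simpa using hx.1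
    have hrange : ∀ c : Fin (k + 1), Set.range (e ∘ c.succAbove) = Set.range e \ {e c} := by
      intro c
      rw [Set.range_comp, Fin.range_succAbove, Set.image_compl_eq_range_sdiff_image e.injective]
      simp
    have hmono : ∀ c : Fin (k + 1), StrictMono (e ∘ c.succAbove) := fun c =>
      e.strictMono.comp (Fin.strictMono_succAbove c)
    have hfa : f = e ∘ a.succAbove := by
      refine (hf.range_inj (hmono a)).1 ?_
      rw [hrange, ha, hr]
      ext z
      have : y ∉ Set.range f := by simpa using hy.2
      simp only [Set.mem_sdiff, Set.mem_insert_iff, Set.mem_singleton_iff]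
      grind
    have hfb : Finset.univ.image (e ∘ b.succAbove) = (insert y (Finset.univ.image f)).erase x := by
      apply Finset.coe_injective
      rw [Finset.coe_image, Finset.coe_univ, Set.image_univ, hrange, hb, hr]
      simp
    have key := ih (hmono b) (by
      have : Finset.univ.image (e ∘ b.succAbove) \ Finset.univ.image g
          = (Finset.univ.image f \ Finset.univ.image g).erase x := by
        rw [hfb]; ext z
        simp only [Finset.mem_sdiff, Finset.mem_erase, Finset.mem_insert]
        have := hy.1
        grind
      rw [this, Finset.card_erase_of_mem (Finset.mem_sdiff.2 hx), hd]; rfl)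
    have h1 := hex e e.strictMono a b
    rw [← hfa] at h1
    have h2 := mul_pos h1 key
    have h3 : 0 < columnMinor C (e ∘ b.succAbove) ^ 2 := by
      have := hne _ (hmono b); positivity
    refine pos_of_mul_pos_right (a := columnMinor C (e ∘ b.succAbove) ^ 2) ?_ h3.le
    nlinarith

/-- The coefficient matrix of a basis of a subspace of `ℝ^n`. -/
def basisMatrix {k n : ℕ} {V : Submodule ℝ (Fin n → ℝ)} (b : Module.Basis (Fin k) ℝ V) :
    Matrix (Fin k) (Fin n) ℝ :=
  Matrix.of fun i => (b i : Fin n → ℝ)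

theorem linearIndependent_basisMatrix {k n : ℕ} {V : Submodule ℝ (Fin n → ℝ)}
    (b : Module.Basis (Fin k) ℝ V) : LinearIndependent ℝ (fun i => basisMatrix b i) :=
  b.linearIndependent.map' V.subtype V.ker_subtype

theorem span_basisMatrix {k n : ℕ} {V : Submodule ℝ (Fin n → ℝ)}
    (b : Module.Basis (Fin k) ℝ V) :
    Submodule.span ℝ (Set.range fun i => basisMatrix b i) = V := by
  have : (Set.range fun i => basisMatrix b i) = V.subtype '' Set.range b := by
    rw [← Set.range_comp]; rfl
  rw [this, Submodule.span_image, b.span_eq, Submodule.map_top, Submodule.range_subtype]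

theorem totPos_of_columnMinor_mul_pos {k n : ℕ} (hk : 0 < k)
    {V : Submodule ℝ (Fin n → ℝ)} (b : Module.Basis (Fin k) ℝ V)
    (h : ∀ f g : Fin k → Fin n, StrictMono f → StrictMono g →
      0 < columnMinor (basisMatrix b) f * columnMinor (basisMatrix b) g) : TotPos k V := by
  by_cases hpos : ∀ f : Fin k → Fin n, StrictMono f → 0 < columnMinor (basisMatrix b) f
  · exact ⟨_, linearIndependent_basisMatrix b, span_basisMatrix b,
      (forall_pluck_pos_iff _).2 hpos⟩
  · push Not at hpos
    obtain ⟨g, hg, hg'⟩ := hpos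
    let u : Fin k → ℝˣ := Function.update 1 ⟨0, hk⟩ (-1)
    refine ⟨_, linearIndependent_basisMatrix (b.unitsSMul u), span_basisMatrix _,
      (forall_pluck_pos_iff _).2 fun f hf => ?_⟩
    have hu : ∏ i, (u i : ℝ) = -1 := by
      rw [Finset.prod_eq_single ⟨0, hk⟩] <;> simp +contextual [u, Function.update_of_ne]
    have hM : columnMinor (basisMatrix (b.unitsSMul u)) f = - columnMinor (basisMatrix b) f := by
      have := Matrix.det_mul_column (fun i => (u i : ℝ)) ((basisMatrix b).submatrix id f)
      rw [hu, neg_one_mul] at this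
      rw [columnMinor, columnMinor, ← this]
      congr 1
      ext i j
      simp [basisMatrix, Module.Basis.unitsSMul_apply, Units.smul_def]
    rw [hM]
    have := h f g hf hg
    nlinarith

theorem mem_span_rows_iff {k n : ℕ} {C : Matrix (Fin k) (Fin n) ℝ} {v : Fin n → ℝ} :
    v ∈ Submodule.span ℝ (Set.range fun i => C i) ↔ ∃ x, x ᵥ* C = v := by
  rw [Submodule.mem_span_range_iff_exists_fun]
  simp only [Matrix.vecMul_eq_sum]

theorem forall_mem_span_rows_sum_eq_zero_iff {k n : ℕ} {C : Matrix (Fin k) (Fin n) ℝ}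
    {w : Fin n → ℝ} :
    (∀ v ∈ Submodule.span ℝ (Set.range fun i => C i), ∑ i, v i * w i = 0) ↔ C *ᵥ w = 0 := by
  constructor
  · exact fun h => funext fun i => h (C i) (Submodule.subset_span ⟨i, rfl⟩)
  · intro h v hv
    obtain ⟨x, rfl⟩ := mem_span_rows_iff.1 hv
    have := Matrix.dotProduct_mulVec x C w
    rw [h, dotProduct_zero] at this
    exact this.symm

section Truncation

variable {n : ℕ} (w : Fin n → ℝ)

/-- The number of sign changes of `w` among the positions up to `i`. -/
def prefixSignChanges (i : Fin n) : ℕ :=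
  signChanges fun j => if j ≤ i then w j else 0

variable {w}

theorem IsSignChain.of_truncate {i : Fin n} {m : ℕ} {f : Fin (m + 1) → Fin n}
    (hf : IsSignChain (fun j => if j ≤ i then w j else 0) f) : IsSignChain w f := by
  refine ⟨hf.1, fun j => ?_⟩
  have h := hf.2 j
  by_cases h1 : f j.castSucc ≤ i <;> by_cases h2 : f j.succ ≤ i <;> simp_all

theorem IsSignChain.le_of_truncate {i : Fin n} {m : ℕ} {f : Fin (m + 1) → Fin n}
    (hf : IsSignChain (fun j => if j ≤ i then w j else 0) f) (hm : 0 < m)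
    (j : Fin (m + 1)) : f j ≤ i := by
  by_contra h
  exact hf.ne_zero hm j (if_neg h)

theorem IsSignChain.truncate {i : Fin n} {m : ℕ} {f : Fin (m + 1) → Fin n}
    (hf : IsSignChain w f) (hi : ∀ j, f j ≤ i) :
    IsSignChain (fun j => if j ≤ i then w j else 0) f :=
  ⟨hf.1, fun j => by simpa [hi] using hf.2 j⟩

theorem le_prefixSignChanges_iff {i : Fin n} {m : ℕ} (hm : 0 < m) :
    m ≤ prefixSignChanges w i ↔ ∃ f : Fin (m + 1) → Fin n, IsSignChain w f ∧ ∀ j, f j ≤ i := by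
  constructor
  · intro h
    obtain ⟨f, hf⟩ := exists_isSignChain_of_le i.pos h
    exact ⟨f, hf.of_truncate, hf.le_of_truncate hm⟩
  · rintro ⟨f, hf, hi⟩
    exact (hf.truncate hi).le_signChanges

theorem prefixSignChanges_le (i : Fin n) : prefixSignChanges w i ≤ signChanges w := by
  rcases Nat.eq_zero_or_pos (prefixSignChanges w i) with h | h
  · omega
  · obtain ⟨f, hf, -⟩ := (le_prefixSignChanges_iff h).1 le_rfl
    exact hf.le_signChanges

theorem prefixSignChanges_mono : Monotone (prefixSignChanges w) := by
  intro i j hij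
  rcases Nat.eq_zero_or_pos (prefixSignChanges w i) with h | h
  · omega
  · obtain ⟨f, hf, hi⟩ := (le_prefixSignChanges_iff h).1 le_rfl
    exact (le_prefixSignChanges_iff h).2 ⟨f, hf, fun a => (hi a).trans hij⟩

theorem prefixSignChanges_eq_zero {i : Fin n} (hi : (i : ℕ) = 0) :
    prefixSignChanges w i = 0 := by
  by_contra h
  obtain ⟨f, hf, hf'⟩ := (le_prefixSignChanges_iff (Nat.pos_of_ne_zero h)).1 le_rfl
  have h1 := hf.1 (show (0 : Fin _) < Fin.last _ from by
    rw [Fin.lt_def]; simpa using Nat.pos_of_ne_zero h)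
  have h2 := hf' (Fin.last _)
  rw [Fin.lt_def] at h1
  rw [Fin.le_def] at h2
  omega

theorem prefixSignChanges_le_succ {i i' : Fin n} (hi : (i' : ℕ) = i + 1) :
    prefixSignChanges w i' ≤ prefixSignChanges w i + 1 := by
  by_contra! h
  obtain ⟨f, hf, hf'⟩ := (le_prefixSignChanges_iff
    (m := prefixSignChanges w i + 1 + 1) (by omega)).1 h
  have : prefixSignChanges w i + 1 ≤ prefixSignChanges w i := by
    refine (le_prefixSignChanges_iff (by omega)).2
      ⟨fun j => f j.castSucc, ⟨hf.1.comp Fin.strictMono_castSucc, fun j => ?_⟩, fun j => ?_⟩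
    · exact hf.2 j.castSucc
    · have hlt : f j.castSucc < i' := (hf.1 j.castSucc_lt_last).trans_le (hf' _)
      rw [Fin.lt_def] at hlt
      change (f j.castSucc : ℕ) ≤ i
      omega
  omega

theorem prefixSignChanges_lt {i j : Fin n} (hij : i < j) (h : w i * w j < 0) :
    prefixSignChanges w i < prefixSignChanges w j := by
  rcases Nat.eq_zero_or_pos (prefixSignChanges w i) with h0 | h0
  · rw [h0]
    refine (le_prefixSignChanges_iff one_pos).2 ⟨![i, j], ⟨?_, ?_⟩, ?_⟩
    · rw [Fin.strictMono_iff_lt_succ]; simpa using hij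
    · simpa using h
    · rw [Fin.forall_fin_two]; simpa using hij.le
  · obtain ⟨f, hf, hi⟩ := (le_prefixSignChanges_iff h0).1 le_rfl
    have hl : w (f (Fin.last _)) ≠ 0 := hf.ne_zero h0 _
    rcases hl.lt_or_gt with hneg | hneg <;>
    rcases mul_neg_iff.1 h with ⟨h1, h2⟩ | ⟨h1, h2⟩
    all_goals first
      | have key : w (f (Fin.last _)) * w j < 0 := by nlinarith
        exact (hf.truncate (i := j) fun a => (hi a).trans hij.le).succ_le_signChanges
          ((hi _).trans_lt hij) (by simpa [(hi _).trans hij.le] using key)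
      | have key : w (f (Fin.last _)) * w i < 0 := by nlinarith
        have hlt : f (Fin.last _) < i := lt_of_le_of_ne (hi _) fun he => by
          rw [he] at key; nlinarith
        have : prefixSignChanges w i + 1 ≤ prefixSignChanges w i :=
          (hf.truncate (i := i) hi).succ_le_signChanges hlt (by simpa [hi] using key)
        omega

end Truncation

/-- The positions of a vector with fewer than `k` sign changes can be grouped into exactly `k`
consecutive nonempty blocks of weakly constant sign. -/
theorem exists_blocks {n k : ℕ} (hkn : k ≤ n) {w : Fin n → ℝ}
    (hw : signChanges w < k) :
    ∃ h : Fin n → Fin k, Monotone h ∧ Function.Surjective h ∧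
      ∀ i j, h i = h j → 0 ≤ w i * w j := by
  let g := prefixSignChanges w
  have hg : ∀ i, g i < k := fun i => (prefixSignChanges_le i).trans_lt hw
  refine ⟨fun i => ⟨max (g i) (i - (n - k)), by have := hg i; omega⟩, ?_, ?_, ?_⟩
  · intro i j hij
    have := prefixSignChanges_mono (w := w) hij
    rw [Fin.le_def] at hij ⊢
    exact max_le_max this (by omega)
  · have hsurj : ∀ m (hm : m < n), ∀ b, b ≤ max (g ⟨m, hm⟩) (m - (n - k)) →
        ∃ i : Fin n, max (g i) (i - (n - k)) = b := by
      intro m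
      induction m with
      | zero =>
        intro hm b hb
        have h0 : g ⟨0, hm⟩ = 0 := prefixSignChanges_eq_zero rfl
        refine ⟨⟨0, hm⟩, ?_⟩
        simp only [h0] at hb ⊢
        omega
      | succ m ih =>
        intro hm b hb
        have h1 : g ⟨m + 1, hm⟩ ≤ g ⟨m, by omega⟩ + 1 := prefixSignChanges_le_succ rfl
        by_cases hb' : b ≤ max (g ⟨m, by omega⟩) (m - (n - k))
        · exact ih _ b hb'
        · exact ⟨⟨m + 1, hm⟩, by dsimp only; omega⟩
    intro b
    obtain ⟨i, hi⟩ := hsurj (n - 1) (by omega) b (by omega)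
    exact ⟨i, Fin.ext hi⟩
  · suffices H : ∀ i j : Fin n, i < j → max (g i) (i - (n - k)) = max (g j) (j - (n - k)) →
        0 ≤ w i * w j by
      intro i j hij
      have hij' := congrArg Fin.val hij
      rcases lt_trichotomy i j with hlt | rfl | hlt
      · exact H i j hlt hij'
      · exact mul_self_nonneg _
      · rw [mul_comm]; exact H j i hlt hij'.symm
    intro i j hij heq
    by_contra! hneg
    have h1 : g i < g j := prefixSignChanges_lt hij hneg
    rw [Fin.lt_def] at hij
    omega

/-- Nonnegative combinations of consecutive blocks of columns inherit a positive determinant. -/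
theorem det_blocks_pos {n k : ℕ} {C : Matrix (Fin k) (Fin n) ℝ}
    (hC : ∀ f : Fin k → Fin n, StrictMono f → 0 < columnMinor C f)
    {h : Fin n → Fin k} (hmono : Monotone h) {a : Fin n → ℝ} (ha : ∀ i, 0 ≤ a i)
    (hpos : ∀ b, ∃ i, h i = b ∧ 0 < a i) :
    0 < (Matrix.of fun b c => ∑ i with h i = b, a i * C c i).det := by
  have hexp : (Matrix.of fun b c => ∑ i with h i = b, a i * C c i).det
      = ∑ r ∈ Fintype.piFinset fun b => {i | h i = b}, (∏ b, a (r b)) * columnMinor C r := by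
    have h1 : (Matrix.of fun b c => ∑ i with h i = b, a i * C c i)
        = fun b => ∑ i with h i = b, a i • fun c => C c i := by
      ext b c; simp
    rw [h1]
    refine ((Matrix.detRowAlternating (n := Fin k) (R := ℝ)).toMultilinearMap.map_sum_finset
      (fun _ i => a i • fun c => C c i) _).trans (Finset.sum_congr rfl fun r _ => ?_)
    rw [MultilinearMap.map_smul_univ, smul_eq_mul]
    congr 1
    exact Matrix.det_transpose (C.submatrix id r)
  have hr : ∀ r ∈ Fintype.piFinset fun b => ({i | h i = b} : Finset (Fin n)), StrictMono r := by
    intro r hr b c hbc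
    simp only [Fintype.mem_piFinset, Finset.mem_filter, Finset.mem_univ, true_and] at hr
    by_contra! hle
    have := hmono hle
    rw [hr, hr] at this
    exact absurd hbc this.not_gt
  rw [hexp]
  choose r₀ hr₀ hr₀' using hpos
  refine Finset.sum_pos' (fun r hr' => mul_nonneg (Finset.prod_nonneg fun b _ => ha _)
    (hC r (hr r hr')).le) ⟨r₀, by simpa using hr₀, ?_⟩
  exact mul_pos (Finset.prod_pos fun b _ => hr₀' b) (hC _ (hr _ (by simpa using hr₀)))

theorem le_signChanges_of_mulVec_eq_zero {n k : ℕ} (hkn : k ≤ n) {C : Matrix (Fin k) (Fin n) ℝ}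
    (hC : ∀ f : Fin k → Fin n, StrictMono f → 0 < columnMinor C f)
    {w : Fin n → ℝ} (hw : C *ᵥ w = 0) (hw0 : w ≠ 0) : k ≤ signChanges w := by
  by_contra! hlt
  obtain ⟨h, hmono, hsurj, hsign⟩ := exists_blocks hkn hlt
  have hblock : ∀ b, ∃ (ε : ℝ) (a : Fin n → ℝ), (∀ i, 0 ≤ a i) ∧ (∃ i, h i = b ∧ 0 < a i) ∧
      ∀ i, h i = b → ε * a i = w i := by
    intro b
    by_cases hz : ∀ i, h i = b → w i = 0
    · obtain ⟨i, hi⟩ := hsurj b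
      exact ⟨0, 1, fun _ => zero_le_one, ⟨i, hi, zero_lt_one⟩, fun j hj => by simp [hz j hj]⟩
    · push Not at hz
      obtain ⟨j, hj, hj0⟩ := hz
      refine ⟨w j, fun i => |w i / w j|, fun i => abs_nonneg _, ⟨j, hj, by simp [hj0]⟩,
        fun i hi => ?_⟩
      have h1 : 0 ≤ w i / w j := by
        rw [← mul_div_mul_right _ _ hj0]
        exact div_nonneg (hsign i j (hi.trans hj.symm)) (mul_self_nonneg _)
      simp only [abs_of_nonneg h1]
      field_simp
  choose ε a ha hpos heq using hblock
  have hdet := det_blocks_pos hC hmono (a := fun i => a (h i) i) (fun i => ha _ i)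
    (fun b => by obtain ⟨i, rfl, hi⟩ := hpos b; exact ⟨i, rfl, hi⟩)
  have hε : ε = 0 := by
    by_contra hε
    refine hdet.ne' (Matrix.exists_vecMul_eq_zero_iff.1 ⟨ε, hε, funext fun c => ?_⟩)
    have : (C *ᵥ w) c = 0 := congrFun hw c
    rw [Pi.zero_apply, ← this]
    simp only [Matrix.vecMul, Matrix.mulVec, dotProduct, Matrix.of_apply, Finset.mul_sum]
    rw [← Finset.sum_fiberwise (g := h)]
    refine Finset.sum_congr rfl fun b _ => Finset.sum_congr rfl fun i hi => ?_
    rw [← heq (h i) i rfl, (Finset.mem_filter.1 hi).2]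
    ring
  exact hw0 (funext fun i => by rw [← heq (h i) i rfl, hε]; simp)

theorem varBar_lt_of_columnMinor_pos {n k : ℕ} (hk : 0 < k) (hn : 0 < n)
    {C : Matrix (Fin k) (Fin n) ℝ}
    (hC : ∀ f : Fin k → Fin n, StrictMono f → 0 < columnMinor C f)
    {x : Fin k → ℝ} (hx : x ᵥ* C ≠ 0) : varBar (x ᵥ* C) < k := by
  by_contra! hle
  obtain ⟨e, he, s, hs, h⟩ := (le_varBar_iff hk hn _).1 hle
  have hq : ∀ a : Fin (k + 1), 0 < columnMinor C (e ∘ a.succAbove) := fun a =>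
    hC _ (he.comp (Fin.strictMono_succAbove a))
  have hsum := congrArg (s * ·) (sum_alternating_columnMinor C e x)
  simp only [Finset.mul_sum, mul_zero] at hsum
  rw [Finset.sum_eq_zero_iff_of_nonneg fun a _ => by
    have := mul_nonneg (h a) (hq a).le
    linarith] at hsum
  have hzero : ∀ a, (x ᵥ* C) (e a) = 0 := fun a => by
    have := hsum a (Finset.mem_univ a)
    simpa [hs, (hq a).ne'] using this
  refine hx ?_
  have : x = 0 := by
    by_contra hx0
    refine (hq 0).ne' (Matrix.exists_vecMul_eq_zero_iff.1 ⟨x, hx0, funext fun j => ?_⟩)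
    exact hzero _
  rw [this, Matrix.zero_vecMul]

theorem columnMinor_ne_zero_of_varBar_lt {n k : ℕ} (hk : 0 < k) (hn : 0 < n)
    {C : Matrix (Fin k) (Fin n) ℝ} (hli : LinearIndependent ℝ fun i => C i)
    (hC : ∀ x, x ᵥ* C ≠ 0 → varBar (x ᵥ* C) < k) {f : Fin k → Fin n} (hf : StrictMono f) :
    columnMinor C f ≠ 0 := by
  intro h0
  obtain ⟨x, hx, hx0⟩ := Matrix.exists_vecMul_eq_zero_iff.2 h0
  have hv : x ᵥ* C ≠ 0 := fun h => hx <|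
    Matrix.vecMul_injective_iff.2 hli (h.trans (Matrix.zero_vecMul C).symm)
  refine (hC x hv).not_ge ((le_varBar_iff hk hn _).2 ?_)
  obtain ⟨i, hi⟩ := Function.ne_iff.1 hv
  have hf0 : ∀ j, (x ᵥ* C) (f j) = 0 := fun j => congrFun hx0 j
  have hif : i ∉ Finset.univ.image f := by
    intro h
    obtain ⟨j, -, rfl⟩ := Finset.mem_image.1 h
    exact hi (hf0 j)
  have hI : (insert i (Finset.univ.image f)).card = k + 1 := by
    rw [Finset.card_insert_of_notMem hif, Finset.card_image_of_injective _ hf.injective]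
    simp
  set e := (insert i (Finset.univ.image f)).orderEmbOfFin hI with he
  have hr : Set.range e = insert i (Set.range f) := by
    rw [he, Finset.range_orderEmbOfFin]; simp
  obtain ⟨c, hc⟩ : i ∈ Set.range e := by simp [hr]
  refine ⟨e, e.strictMono, (-1) ^ (c : ℕ) * (x ᵥ* C) i,
    mul_ne_zero (pow_ne_zero _ (by norm_num)) hi, fun j => ?_⟩
  rcases eq_or_ne j c with rfl | hj
  · rw [hc]
    have : (-1 : ℝ) ^ (j : ℕ) * (x ᵥ* C) i * (-1) ^ (j : ℕ) * (x ᵥ* C) i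
        = ((-1) ^ (j : ℕ) * (x ᵥ* C) i) ^ 2 := by ring
    rw [this]
    positivity
  · have : e j ∈ insert i (Set.range f) := hr ▸ Set.mem_range_self j
    obtain h | ⟨l, hl⟩ := this
    · exact absurd (e.injective (h.trans hc.symm)) hj
    · rw [← hl, hf0, mul_zero]

theorem columnMinor_mul_pos_of_varBar_lt {n k : ℕ} (hk : 0 < k) (hn : 0 < n)
    {C : Matrix (Fin k) (Fin n) ℝ}
    (hC : ∀ x, x ᵥ* C ≠ 0 → varBar (x ᵥ* C) < k)
    (hne : ∀ f : Fin k → Fin n, StrictMono f → columnMinor C f ≠ 0)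
    {e : Fin (k + 1) → Fin n} (he : StrictMono e) (a b : Fin (k + 1)) :
    0 < columnMinor C (e ∘ a.succAbove) * columnMinor C (e ∘ b.succAbove) := by
  have hq : ∀ c : Fin (k + 1), columnMinor C (e ∘ c.succAbove) ≠ 0 := fun c =>
    hne _ (he.comp (Fin.strictMono_succAbove c))
  rcases eq_or_ne b a with rfl | hab
  · exact mul_self_pos.2 (hq _)
  by_contra! hle
  obtain ⟨j, rfl⟩ := Fin.exists_succAbove_eq hab
  set b := a.succAbove j
  obtain ⟨x, hx⟩ : ∃ x, x ᵥ* C.submatrix id (e ∘ a.succAbove) = Pi.single j 1 :=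
    Matrix.vecMul_surjective_iff_isUnit.2
      ((Matrix.isUnit_iff_isUnit_det _).2 (isUnit_iff_ne_zero.2 (hq a))) _
  have hx' : ∀ l, (x ᵥ* C) (e (a.succAbove l)) = Pi.single (M := fun _ => ℝ) j 1 l := fun l =>
    congrFun hx l
  have hb : (x ᵥ* C) (e b) = 1 := by rw [hx', Pi.single_eq_same]
  have hc : ∀ c, c ≠ a → c ≠ b → (x ᵥ* C) (e c) = 0 := by
    intro c hca hcb
    obtain ⟨l, rfl⟩ := Fin.exists_succAbove_eq hca
    rw [hx', Pi.single_eq_of_ne]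
    rintro rfl
    exact hcb rfl
  have hv : x ᵥ* C ≠ 0 := fun h => by simp [h] at hb
  refine (hC x hv).not_ge ((le_varBar_iff hk hn _).2
    ⟨e, he, (-1) ^ (b : ℕ), pow_ne_zero _ (by norm_num), fun c => ?_⟩)
  have hsq : ∀ m : ℕ, ((-1 : ℝ) ^ m) * (-1) ^ m = 1 := fun m => by
    rw [← mul_pow]; simp
  have hsum := sum_alternating_columnMinor C e x
  rw [Fintype.sum_eq_add a b hab.symm fun c h => by rw [hc c h.1 h.2]; ring, hb] at hsum
  rcases eq_or_ne c b with rfl | hcb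
  · rw [hb, hsq]; norm_num
  rcases eq_or_ne c a with rfl | hca
  · have h2 : 0 < columnMinor C (e ∘ c.succAbove) ^ 2 := by have := hq c; positivity
    refine nonneg_of_mul_nonneg_right (a := columnMinor C (e ∘ c.succAbove) ^ 2) ?_ h2
    have : columnMinor C (e ∘ c.succAbove) ^ 2 *
        ((-1) ^ (b : ℕ) * (-1) ^ (c : ℕ) * (x ᵥ* C) (e c))
        = -(columnMinor C (e ∘ c.succAbove) * columnMinor C (e ∘ b.succAbove)) *
          ((-1) ^ (b : ℕ) * (-1) ^ (b : ℕ)) := by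
      linear_combination (-1) ^ (b : ℕ) * columnMinor C (e ∘ c.succAbove) * hsum
    rw [this, hsq]
    linarith
  · rw [hc c hca hcb, mul_zero]

theorem mulVec_extend {n k m : ℕ} (C : Matrix (Fin k) (Fin n) ℝ) {e : Fin m → Fin n}
    (he : Function.Injective e) (y : Fin m → ℝ) (c : Fin k) :
    (C *ᵥ Function.extend e y 0) c = ∑ a, C c (e a) * y a := by
  refine (Fintype.sum_of_injective e he _ _ (fun i hi => ?_) fun a => ?_).symm
  · rw [Function.extend_apply' _ _ _ (by simpa using hi)]; simp
  · rw [he.extend_apply]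

theorem range_subset_of_isSignChain_extend {n m l : ℕ} {e : Fin l → Fin n} {y : Fin l → ℝ}
    (hm : 0 < m) {f : Fin (m + 1) → Fin n} (hf : IsSignChain (Function.extend e y 0) f) :
    Set.range f ⊆ Set.range e := by
  rintro _ ⟨j, rfl⟩
  by_contra h
  exact hf.ne_zero hm j (by rw [Function.extend_apply' _ _ _ (by simpa using h)]; rfl)

theorem columnMinor_ne_zero_of_le_signChanges {n k : ℕ} (hk : 0 < k) (hn : 0 < n)
    {C : Matrix (Fin k) (Fin n) ℝ}
    (hC : ∀ w, C *ᵥ w = 0 → w ≠ 0 → k ≤ signChanges w) {f : Fin k → Fin n} (hf : StrictMono f) :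
    columnMinor C f ≠ 0 := by
  intro h0
  obtain ⟨y, hy, hy0⟩ := Matrix.exists_mulVec_eq_zero_iff.2 h0
  have hw := hC (Function.extend f y 0)
    (funext fun c => (mulVec_extend C hf.injective y c).trans (congrFun hy0 c))
    (fun h => hy <| funext fun j => by
      rw [← hf.injective.extend_apply y 0 j, h]; rfl)
  obtain ⟨g, hg⟩ := exists_isSignChain_of_le hn hw
  have hsub := range_subset_of_isSignChain_extend hk hg
  have := Set.ncard_le_ncard hsub
  rw [← Set.image_univ, ← Set.image_univ, Set.ncard_image_of_injective _ hg.1.injective,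
    Set.ncard_image_of_injective _ hf.injective] at this
  simp at this

theorem columnMinor_mul_pos_of_le_signChanges {n k : ℕ} (hk : 0 < k) (hn : 0 < n)
    {C : Matrix (Fin k) (Fin n) ℝ}
    (hC : ∀ w, C *ᵥ w = 0 → w ≠ 0 → k ≤ signChanges w)
    {e : Fin (k + 1) → Fin n} (he : StrictMono e) (a b : Fin (k + 1)) :
    0 < columnMinor C (e ∘ a.succAbove) * columnMinor C (e ∘ b.succAbove) := by
  have hq : ∀ c : Fin (k + 1), columnMinor C (e ∘ c.succAbove) ≠ 0 := fun c =>
    columnMinor_ne_zero_of_le_signChanges hk hn hC (he.comp (Fin.strictMono_succAbove c))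
  let y : Fin (k + 1) → ℝ := fun a => (-1) ^ (a : ℕ) * columnMinor C (e ∘ a.succAbove)
  have hy : ∀ c, y c ≠ 0 := fun c => mul_ne_zero (pow_ne_zero _ (by norm_num)) (hq c)
  have hw := hC (Function.extend e y 0)
    (funext fun c => (mulVec_extend C he.injective y c).trans
      (sum_mul_alternating_columnMinor C e c))
    (fun h => hy 0 <| by rw [← he.injective.extend_apply y 0 0, h]; rfl)
  obtain ⟨g, hg⟩ := exists_isSignChain_of_le hn hw
  have hsub := range_subset_of_isSignChain_extend hk hg
  have hge : g = e := by
    refine (hg.1.range_inj he).1 (Set.eq_of_subset_of_ncard_le hsub ?_)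
    rw [← Set.image_univ, ← Set.image_univ, Set.ncard_image_of_injective _ hg.1.injective,
      Set.ncard_image_of_injective _ he.injective]
  subst hge
  have halt := hg.alternates (hg.ne_zero hk 0)
  have hsq : ∀ m : ℕ, ((-1 : ℝ) ^ m) * (-1) ^ m = 1 := fun m => by
    rw [← mul_pow]; simp
  have hpos : ∀ c : Fin (k + 1), 0 < y 0 * columnMinor C (g ∘ c.succAbove) := fun c => by
    have := halt c
    rw [he.injective.extend_apply, he.injective.extend_apply, mul_assoc] at this
    simpa only [y, ← mul_assoc, hsq, one_mul] using this
  have h2 : 0 < y 0 ^ 2 := by have := hy 0; positivity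
  refine pos_of_mul_pos_right (a := y 0 ^ 2) ?_ h2.le
  have := mul_pos (hpos a) (hpos b)
  nlinarith

/-- Gantmakher–Krein: characterization of the totally positive Grassmannian by
sign variation. -/
theorem stmt1 (k n : ℕ) (hk : 0 < k) (hkn : k < n)
    (V : Submodule ℝ (Fin n → ℝ)) (hV : Module.finrank ℝ V = k)
    (W : Submodule ℝ (Fin n → ℝ))
    (hW : ∀ w : Fin n → ℝ, w ∈ W ↔ ∀ v ∈ V, ∑ i, v i * w i = 0) :
    (TotPos k V ↔ ∀ v : Fin n → ℝ, v ∈ V → v ≠ 0 → varBar v ≤ k - 1) ∧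
    (TotPos k V ↔ ∀ w : Fin n → ℝ, w ∈ W → w ≠ 0 → k ≤ signChanges w) := by
  have hn : 0 < n := hk.trans hkn
  let b : Module.Basis (Fin k) ℝ V := Module.finBasisOfFinrankEq ℝ V hV
  have hbV : ∀ x, x ᵥ* basisMatrix b ∈ V := fun x => by
    have := mem_span_rows_iff.2 (Exists.intro x (rfl : x ᵥ* basisMatrix b = _))
    rwa [span_basisMatrix b] at this
  have hbW : ∀ w, basisMatrix b *ᵥ w = 0 → w ∈ W := fun w h => by
    rw [hW, ← span_basisMatrix b]
    exact forall_mem_span_rows_sum_eq_zero_iff.2 h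
  refine ⟨⟨?_, fun H => ?_⟩, ⟨?_, fun H => ?_⟩⟩
  · rintro ⟨C, -, rfl, hC⟩ v hv hv0
    obtain ⟨x, rfl⟩ := mem_span_rows_iff.1 hv
    exact Nat.le_sub_one_of_lt
      (varBar_lt_of_columnMinor_pos hk hn ((forall_pluck_pos_iff C).1 hC) hv0)
  · have H' : ∀ x, x ᵥ* basisMatrix b ≠ 0 → varBar (x ᵥ* basisMatrix b) < k := fun x hx => by
      have := H _ (hbV x) hx
      omega
    have hne : ∀ f : Fin k → Fin n, StrictMono f → columnMinor (basisMatrix b) f ≠ 0 :=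
      fun f hf => columnMinor_ne_zero_of_varBar_lt hk hn (linearIndependent_basisMatrix b) H' hf
    exact totPos_of_columnMinor_mul_pos hk b fun f g hf hg => columnMinor_mul_pos _ hne
      (fun e he => columnMinor_mul_pos_of_varBar_lt hk hn H' hne he) hf hg
  · rintro ⟨C, -, rfl, hC⟩ w hw hw0
    exact le_signChanges_of_mulVec_eq_zero hkn.le ((forall_pluck_pos_iff C).1 hC)
      (forall_mem_span_rows_sum_eq_zero_iff.1 ((hW w).1 hw)) hw0
  · have H' : ∀ w, basisMatrix b *ᵥ w = 0 → w ≠ 0 → k ≤ signChanges w := fun w hw =>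
      H w (hbW w hw)
    exact totPos_of_columnMinor_mul_pos hk b fun f g hf hg => columnMinor_mul_pos _
      (fun _ => columnMinor_ne_zero_of_le_signChanges hk hn H')
      (fun _ he => columnMinor_mul_pos_of_le_signChanges hk hn H' he) hf hg
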